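/- arXiv:2302.00964 — 2 statements merged into one kernel-verified Lean document; each statement's English description precedes it below -/
import Mathlib

section
/- For every integer n ≥ 0, δ₆(n) = (1/8)·Σ_{(a,b) ∈ ℕ², a+2b=n} r₃(a)·r₃(8b + 3). -/
/-- `deltaRep k c n` is the number of `k`-tuples `(x₁, …, x_k)` of nonnegative integers
with `n = Σᵢ cᵢ · xᵢ(xᵢ+1)/2`. -/
noncomputable def deltaRep (k : ℕ) (c : Fin k → ℕ) (n : ℕ) : ℕ :=
  Set.ncard {x : Fin k → ℕ | n = ∑ i, c i * (x i * (x i + 1) / 2)}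

/-- `rRep v b n` is the number of `v`-tuples `(y₁, …, y_v)` of integers with
`n = Σᵢ bᵢ · yᵢ²`. -/
noncomputable def rRep (v : ℕ) (b : Fin v → ℕ) (n : ℕ) : ℕ :=
  Set.ncard {y : Fin v → ℤ | (n : ℤ) = ∑ i, (b i : ℤ) * y i ^ 2}

/-- `qRep k c n` is the number of `k`-tuples `(y₁, …, y_k)` of positive odd integers with
`n = Σᵢ cᵢ · yᵢ²`. -/
noncomputable def qRep (k : ℕ) (c : Fin k → ℕ) (n : ℕ) : ℕ :=
  Set.ncard {y : Fin k → ℕ | (∀ i, 0 < y i ∧ Odd (y i)) ∧ n = ∑ i, c i * y i ^ 2}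

/-- `NstRep v k b c n` is the number of pairs of tuples `((y₁, …, y_v), (z₁, …, z_k))`
with the `yᵢ` integers and the `z_j` nonnegative integers such that
`n = Σᵢ bᵢ·yᵢ² + Σⱼ cⱼ·zⱼ(zⱼ+1)/2`. -/
noncomputable def NstRep (v k : ℕ) (b : Fin v → ℕ) (c : Fin k → ℕ) (n : ℕ) : ℕ :=
  Set.ncard {p : (Fin v → ℤ) × (Fin k → ℕ) |
    (n : ℤ) = ∑ i, (b i : ℤ) * p.1 i ^ 2 +
      ∑ j, (c j : ℤ) * ((p.2 j * (p.2 j + 1) / 2 : ℕ) : ℤ)}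

/-- The finite set of pairs `(a, b)` of nonnegative integers with `a + 2b = n`. -/
def convPairs (n : ℕ) : Finset (ℕ × ℕ) :=
  (Finset.range (n + 1) ×ˢ Finset.range (n + 1)).filter fun p => p.1 + 2 * p.2 = n

/-- The bijection `(u, z) ↦ (x, y)` from `ℤ × ℕ` onto `ℕ × ℕ` along which
`u² + z(z+1) = x(x+1)/2 + y(y+1)/2`. -/
def squareTriangularEquiv : ℤ × ℕ ≃ ℕ × ℕ where
  toFun p :=
    ((if 0 ≤ p.1 + p.2 then p.1 + p.2 else -(p.1 + p.2) - 1).toNat,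
      (if 0 ≤ p.2 - p.1 then p.2 - p.1 else p.1 - p.2 - 1).toNat)
  invFun q :=
    if (q.1 + q.2) % 2 = 0 then (((q.1 : ℤ) - q.2) / 2, (q.1 + q.2) / 2)
    else if q.2 < q.1 then (((q.1 : ℤ) + q.2 + 1) / 2, (q.1 - q.2 - 1) / 2)
    else (-(((q.1 : ℤ) + q.2 + 1) / 2), (q.2 - q.1 - 1) / 2)
  left_inv := by
    rintro ⟨u, z⟩
    dsimp only
    split_ifs <;> simp only [Prod.mk.injEq] <;> omega
  right_inv := by
    rintro ⟨x, y⟩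
    dsimp only
    split_ifs <;> simp only [Prod.mk.injEq] <;> omega

lemma two_mul_cast_triangular (x : ℕ) :
    2 * ((x * (x + 1) / 2 : ℕ) : ℤ) = (x : ℤ) * (x + 1) := by
  exact_mod_cast Nat.mul_div_cancel' (Nat.even_mul_succ_self x).two_dvd

lemma triangular_add_triangular_squareTriangularEquiv (p : ℤ × ℕ) :
    ((((squareTriangularEquiv p).1 * ((squareTriangularEquiv p).1 + 1) / 2 : ℕ) : ℤ) +
      (((squareTriangularEquiv p).2 * ((squareTriangularEquiv p).2 + 1) / 2 : ℕ) : ℤ)) =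
      p.1 ^ 2 + 2 * ((p.2 * (p.2 + 1) / 2 : ℕ) : ℤ) := by
  have hx := two_mul_cast_triangular (squareTriangularEquiv p).1
  have hy := two_mul_cast_triangular (squareTriangularEquiv p).2
  have hz := two_mul_cast_triangular p.2
  have key : ((squareTriangularEquiv p).1 : ℤ) * ((squareTriangularEquiv p).1 + 1) +
      ((squareTriangularEquiv p).2 : ℤ) * ((squareTriangularEquiv p).2 + 1) =
      2 * p.1 ^ 2 + 2 * ((p.2 : ℤ) * (p.2 + 1)) := by
    have h1 : ((squareTriangularEquiv p).1 : ℤ) =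
        if 0 ≤ p.1 + p.2 then p.1 + p.2 else -(p.1 + p.2) - 1 := by
      simp only [squareTriangularEquiv, Equiv.coe_fn_mk]
      split_ifs <;> omega
    have h2 : ((squareTriangularEquiv p).2 : ℤ) =
        if 0 ≤ p.2 - p.1 then p.2 - p.1 else p.1 - p.2 - 1 := by
      simp only [squareTriangularEquiv, Equiv.coe_fn_mk]
      split_ifs <;> omega
    rw [h1, h2]
    split_ifs <;> ring
  linarith

/-- `squareTriangularEquiv` applied coordinatewise to tuples. -/
def squareTriangularTupleEquiv (k : ℕ) :
    (Fin k → ℤ) × (Fin k → ℕ) ≃ (Fin (k + k) → ℕ) :=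
  (Equiv.arrowProdEquivProdArrow (Fin k) (fun _ => ℤ) (fun _ => ℕ)).symm.trans <|
    (Equiv.arrowCongr (Equiv.refl (Fin k)) squareTriangularEquiv).trans <|
      (Equiv.arrowProdEquivProdArrow (Fin k) (fun _ => ℕ) (fun _ => ℕ)).trans
        (Fin.appendEquiv k k)

lemma sum_triangular_squareTriangularTupleEquiv (k : ℕ) (p : (Fin k → ℤ) × (Fin k → ℕ)) :
    ((∑ i, squareTriangularTupleEquiv k p i * (squareTriangularTupleEquiv k p i + 1) / 2 : ℕ) : ℤ)
      = ∑ i, p.1 i ^ 2 + 2 * ((∑ i, p.2 i * (p.2 i + 1) / 2 : ℕ) : ℤ) := by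
  rw [Fin.sum_univ_add]
  push_cast [Finset.mul_sum, ← Finset.sum_add_distrib]
  refine Finset.sum_congr rfl fun i _ => ?_
  have h := triangular_add_triangular_squareTriangularEquiv (p.1 i, p.2 i)
  push_cast at h
  have hl : squareTriangularTupleEquiv k p (Fin.castAdd k i) =
      (squareTriangularEquiv (p.1 i, p.2 i)).1 := Fin.append_left _ _ i
  have hr : squareTriangularTupleEquiv k p (Fin.natAdd k i) =
      (squareTriangularEquiv (p.1 i, p.2 i)).2 := Fin.append_right _ _ i
  rw [hl, hr]
  exact h

lemma finite_setOf_sum_sq_eq (k n : ℕ) : {y : Fin k → ℤ | (n : ℤ) = ∑ i, y i ^ 2}.Finite := by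
  refine (Set.finite_Icc (fun _ => -(n : ℤ)) (fun _ => (n : ℤ))).subset fun y hy => ?_
  have h (i : Fin k) : y i ^ 2 ≤ n := by
    rw [show (n : ℤ) = ∑ i, y i ^ 2 from hy]
    exact Finset.single_le_sum (f := fun i => y i ^ 2) (fun j _ => sq_nonneg _) (Finset.mem_univ i)
  have habs (i : Fin k) : |y i| ≤ n := by
    rw [Int.abs_eq_natAbs]
    refine le_trans ?_ (h i)
    exact Int.natAbs_le_self_sq (y i)
  exact ⟨fun i => (abs_le.mp (habs i)).1, fun i => (abs_le.mp (habs i)).2⟩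

lemma finite_setOf_sum_triangular_eq (k n : ℕ) :
    {x : Fin k → ℕ | n = ∑ i, x i * (x i + 1) / 2}.Finite := by
  refine (Set.finite_Icc (fun _ => 0) (fun _ => n)).subset fun x hx => ?_
  refine ⟨fun i => Nat.zero_le _, fun i => ?_⟩
  have h : x i * (x i + 1) / 2 ≤ n := by
    rw [show n = ∑ i, x i * (x i + 1) / 2 from hx]
    exact Finset.single_le_sum (f := fun i => x i * (x i + 1) / 2)
      (fun j _ => Nat.zero_le _) (Finset.mem_univ i)
  refine le_trans ?_ h
  rw [Nat.le_div_iff_mul_le two_pos]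
  nlinarith [Nat.le_mul_self (x i)]

lemma mem_convPairs {n : ℕ} {p : ℕ × ℕ} : p ∈ convPairs n ↔ p.1 + 2 * p.2 = n := by
  simp only [convPairs, Finset.mem_filter, Finset.mem_product, Finset.mem_range]
  omega

/-- The coefficient form of `ψ(q)^(2k) = φ(q)^k ψ(q²)^k`. -/
theorem deltaRep_add_self (k n : ℕ) :
    deltaRep (k + k) (fun _ => 1) n =
      ∑ p ∈ convPairs n, rRep k (fun _ => 1) p.1 * deltaRep k (fun _ => 1) p.2 := by
  simp only [deltaRep, rRep, one_mul, Nat.cast_one]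
  have himage : {x : Fin (k + k) → ℕ | n = ∑ i, x i * (x i + 1) / 2} =
      squareTriangularTupleEquiv k '' ⋃ p ∈ (convPairs n : Set (ℕ × ℕ)),
        {y : Fin k → ℤ | (p.1 : ℤ) = ∑ i, y i ^ 2} ×ˢ
          {x : Fin k → ℕ | p.2 = ∑ i, x i * (x i + 1) / 2} := by
    rw [Equiv.image_eq_preimage_symm]
    ext x
    obtain ⟨q, rfl⟩ := (squareTriangularTupleEquiv k).surjective x
    have h := sum_triangular_squareTriangularTupleEquiv k q
    simp only [Set.mem_preimage, Equiv.symm_apply_apply, Set.mem_iUnion, Set.mem_prod,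
      Set.mem_ofPred_eq, Finset.mem_coe, mem_convPairs, exists_prop]
    constructor
    · intro hn
      have hnn : 0 ≤ ∑ i, q.1 i ^ 2 := Finset.sum_nonneg fun i _ => sq_nonneg _
      refine ⟨((∑ i, q.1 i ^ 2).toNat, ∑ i, q.2 i * (q.2 i + 1) / 2), ?_, ?_, rfl⟩
      · dsimp only
        omega
      · exact Int.toNat_of_nonneg hnn
    · rintro ⟨p, hp, h1, h2⟩
      omega
  rw [himage, Set.ncard_image_of_injective _ (squareTriangularTupleEquiv k).injective,
    Set.Finite.ncard_biUnion (Finset.finite_toSet _), finsum_mem_coe_finset]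
  · exact Finset.sum_congr rfl fun p _ => Set.ncard_prod
  · exact fun p _ => (finite_setOf_sum_sq_eq k p.1).prod (finite_setOf_sum_triangular_eq k p.2)
  · rintro ⟨a, b⟩ - ⟨c, d⟩ - hne
    refine Set.disjoint_left.mpr ?_
    rintro q ⟨h1, h2⟩ ⟨h3, h4⟩
    simp only [Set.mem_ofPred_eq] at h1 h2 h3 h4
    exact hne (Prod.ext (by exact_mod_cast h1.trans h3.symm) (h2.trans h4.symm))

/-- The odd integer of absolute value `2z + 1` with sign prescribed by the boolean. -/
def signedOdd (s : Bool) (z : ℕ) : ℤ := if s then 2 * z + 1 else -(2 * z + 1)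

lemma signedOdd_sq (s : Bool) (z : ℕ) :
    signedOdd s z ^ 2 = 8 * ((z * (z + 1) / 2 : ℕ) : ℤ) + 1 := by
  have h := two_mul_cast_triangular z
  cases s <;> simp only [signedOdd, if_true, if_false, Bool.false_eq_true] <;> nlinarith

lemma signedOdd_inj {s t : Bool} {z w : ℕ} (h : signedOdd s z = signedOdd t w) :
    s = t ∧ z = w := by
  cases s <;> cases t <;> simp [signedOdd] at h ⊢ <;> omega

lemma exists_signedOdd_eq {y : ℤ} (hy : y % 2 = 1) : ∃ s z, signedOdd s z = y := by
  rcases le_or_gt 0 y with h | h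
  · exact ⟨true, (y / 2).toNat, by simp [signedOdd]; omega⟩
  · exact ⟨false, (-y / 2).toNat, by simp [signedOdd]; omega⟩

lemma emod_two_eq_one_of_sum_three_sq {y : Fin 3 → ℤ} {b : ℕ}
    (h : ((8 * b + 3 : ℕ) : ℤ) = ∑ i, y i ^ 2) (i : Fin 3) : y i % 2 = 1 := by
  have hsq (x : ℤ) : x % 2 = 0 ∧ x ^ 2 % 4 = 0 ∨ x % 2 = 1 ∧ x ^ 2 % 4 = 1 := by
    rcases Int.emod_two_eq_zero_or_one x with hx | hx
    · obtain ⟨m, rfl⟩ := Int.dvd_of_emod_eq_zero hx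
      exact .inl ⟨hx, Int.emod_eq_zero_of_dvd ⟨m ^ 2, by ring⟩⟩
    · exact .inr ⟨hx, Int.sq_mod_four_eq_one_of_odd (Int.odd_iff.mpr hx)⟩
  rw [Fin.sum_univ_three] at h
  have h0 := hsq (y 0)
  have h1 := hsq (y 1)
  have h2 := hsq (y 2)
  fin_cases i <;> simp only [Fin.zero_eta, Fin.mk_one, Fin.reduceFinMk] <;> omega

theorem rRep_three_eight_mul_add_three (b : ℕ) :
    rRep 3 (fun _ => 1) (8 * b + 3) = 8 * deltaRep 3 (fun _ => 1) b := by
  simp only [deltaRep, rRep, one_mul, Nat.cast_one]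
  let f : (Fin 3 → Bool) × (Fin 3 → ℕ) → Fin 3 → ℤ := fun p i => signedOdd (p.1 i) (p.2 i)
  have hf : f.Injective := fun p q h =>
    Prod.ext (funext fun i => (signedOdd_inj (congrFun h i)).1)
      (funext fun i => (signedOdd_inj (congrFun h i)).2)
  have hsum (p : (Fin 3 → Bool) × (Fin 3 → ℕ)) :
      ∑ i, f p i ^ 2 = 8 * ((∑ i, p.2 i * (p.2 i + 1) / 2 : ℕ) : ℤ) + 3 := by
    simp only [f, signedOdd_sq, Fin.sum_univ_three]
    omega
  have himage : {y : Fin 3 → ℤ | ((8 * b + 3 : ℕ) : ℤ) = ∑ i, y i ^ 2} =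
      f '' (Set.univ ×ˢ {x : Fin 3 → ℕ | b = ∑ i, x i * (x i + 1) / 2}) := by
    ext y
    simp only [Set.mem_ofPred_eq, Set.mem_image, Set.mem_prod, Set.mem_univ, true_and]
    constructor
    · intro hy
      choose s z hsz using fun i => exists_signedOdd_eq (emod_two_eq_one_of_sum_three_sq hy i)
      have hfy : f (s, z) = y := funext hsz
      refine ⟨(s, z), ?_, hfy⟩
      rw [← hfy, hsum] at hy
      dsimp only at hy ⊢
      omega
    · rintro ⟨p, hp, rfl⟩
      rw [hsum, ← hp]
      push_cast
      rfl
  rw [himage, Set.ncard_image_of_injective _ hf, Set.ncard_prod, Set.ncard_univ]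
  simp

theorem delta_six_formula (n : ℕ) :
    (deltaRep 6 (fun _ => 1) n : ℚ) =
      (1 / 8) * ∑ p ∈ convPairs n,
        (rRep 3 (fun _ => 1) p.1 : ℚ) * (rRep 3 (fun _ => 1) (8 * p.2 + 3) : ℚ) := by
  have h : deltaRep 6 (fun _ => 1) n =
      ∑ p ∈ convPairs n, rRep 3 (fun _ => 1) p.1 * deltaRep 3 (fun _ => 1) p.2 :=
    deltaRep_add_self 3 n
  simp only [h, rRep_three_eight_mul_add_three, Finset.mul_sum, Nat.cast_sum, Nat.cast_mul]
  refine Finset.sum_congr rfl fun p _ => ?_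
  push_cast
  ring
end

section
/- For every integer n ≥ 0, δ₁₆(n) = Σ_{(a,b) ∈ ℕ², a+2b=n} r₈(a)·σ₃^#(b + 1), where σ₃^#(m) = Σ_{d∣m, m/d odd} d³ for positive integers m. -/
/-- The triples `(x, d, e)` with `d, e > 0` and `x² + 4de = N`. -/
noncomputable def discTriples (N : ℕ) : Finset (ℤ × ℤ × ℤ) :=
  (Finset.Icc (-(N : ℤ)) N ×ˢ Finset.Icc (1 : ℤ) N ×ˢ Finset.Icc (1 : ℤ) N).filter
    fun p => p.1 ^ 2 + 4 * p.2.1 * p.2.2 = N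

theorem mem_discTriples {N : ℕ} {x d e : ℤ} :
    (x, d, e) ∈ discTriples N ↔ 0 < d ∧ 0 < e ∧ x ^ 2 + 4 * d * e = N := by
  simp only [discTriples, Finset.mem_filter, Finset.mem_product, Finset.mem_Icc]
  constructor
  · rintro ⟨⟨-, ⟨h1, -⟩, h2, -⟩, h⟩
    exact ⟨by omega, by omega, h⟩
  · rintro ⟨hd, he, h⟩
    refine ⟨⟨⟨?_, ?_⟩, ⟨by omega, ?_⟩, ⟨by omega, ?_⟩⟩, h⟩ <;> nlinarith [mul_pos hd he, sq_nonneg x, sq_nonneg (x-1), sq_nonneg (x+1)]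

theorem sum_discTriples_odd (N : ℕ) (g : ℤ → ℤ → ℤ) :
    ∑ p ∈ discTriples N, p.1 * g p.2.1 p.2.2 = 0 := by
  have h : ∑ p ∈ discTriples N, p.1 * g p.2.1 p.2.2
      = ∑ p ∈ discTriples N, -(p.1 * g p.2.1 p.2.2) := by
    refine Finset.sum_nbij' (fun p => (-p.1, p.2)) (fun p => (-p.1, p.2)) ?_ ?_ ?_ ?_ ?_
    · rintro ⟨x, d, e⟩ h
      rw [mem_discTriples] at *
      simpa using h
    · rintro ⟨x, d, e⟩ h
      rw [mem_discTriples] at *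
      simpa using h
    · simp
    · simp
    · simp
  rw [Finset.sum_neg_distrib] at h
  omega

theorem sum_discTriples_eq_zero (n : ℕ) :
    ∑ p ∈ discTriples (8 * n + 5), (p.2.1 * p.2.2 - p.1 ^ 2) * p.2.1 = 0 := by
  set N := 8 * n + 5 with hN
  set f : ℤ × ℤ × ℤ → ℤ := fun p =>
    (p.2.1 * p.2.2 - p.1 ^ 2) * p.2.1 + p.1 * p.2.1 ^ 2 with hf
  have h1 : ∑ p ∈ discTriples N, (p.2.1 * p.2.2 - p.1 ^ 2) * p.2.1
      = ∑ p ∈ discTriples N, f p := by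
    rw [hf, Finset.sum_add_distrib, sum_discTriples_odd N fun d _ => d ^ 2, add_zero]
  have h2 : ∑ p ∈ discTriples N with ¬ 0 < p.2.1 - p.1 - p.2.2, f p
      = ∑ p ∈ discTriples N with 0 < p.2.1 - p.1 - p.2.2, f (-p.1, p.2.2, p.2.1) := by
    refine Finset.sum_nbij' (fun p => (-p.1, p.2.2, p.2.1)) (fun p => (-p.1, p.2.2, p.2.1))
      ?_ ?_ (by simp) (by simp) (by simp)
    · rintro ⟨x, d, e⟩ h
      rw [Finset.mem_filter, mem_discTriples] at *
      obtain ⟨⟨hd, he, h⟩, h'⟩ := h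
      refine ⟨⟨he, hd, by rw [← h]; ring⟩, ?_⟩
      have : d - x - e ≠ 0 := by
        intro h0
        obtain rfl : x = d - e := by omega
        have h8 : (d + e) ^ 2 = 8 * (n : ℤ) + 5 := by rw [hN] at h; push_cast at h; linarith
        have := congrArg (fun z : ℤ => z % 8) h8
        have h9 : (d + e) % 8 = 0 ∨ (d + e) % 8 = 1 ∨ (d + e) % 8 = 2 ∨ (d + e) % 8 = 3 ∨
          (d + e) % 8 = 4 ∨ (d + e) % 8 = 5 ∨ (d + e) % 8 = 6 ∨ (d + e) % 8 = 7 := by omega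
        rcases h9 with h | h | h | h | h | h | h | h <;> simp [pow_two, Int.mul_emod, h] at this
      simp only at h' ⊢
      omega
    · rintro ⟨x, d, e⟩ h
      rw [Finset.mem_filter, mem_discTriples] at *
      obtain ⟨⟨hd, he, h⟩, h'⟩ := h
      refine ⟨⟨he, hd, by rw [← h]; ring⟩, ?_⟩
      simp only at h' ⊢
      omega
  have h3 : ∑ p ∈ discTriples N with 0 < p.2.1 - p.1 - p.2.2, (f p + f (-p.1, p.2.2, p.2.1))
      = ∑ p ∈ discTriples N with 0 < p.2.1 - p.1 - p.2.2,
        -(f p + f (-p.1, p.2.2, p.2.1)) := by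
    have key : ∀ p ∈ (discTriples N).filter fun p => 0 < p.2.1 - p.1 - p.2.2,
        ((-p.1 - 2 * p.2.2, p.2.1 - p.1 - p.2.2, p.2.2) : ℤ × ℤ × ℤ) ∈
          (discTriples N).filter fun p => 0 < p.2.1 - p.1 - p.2.2 := by
      rintro ⟨x, d, e⟩ h
      rw [Finset.mem_filter, mem_discTriples] at *
      obtain ⟨⟨hd, he, h⟩, h'⟩ := h
      refine ⟨⟨h', he, by rw [← h]; ring⟩, ?_⟩
      simp only at h' ⊢
      omega
    refine Finset.sum_nbij' (fun p => (-p.1 - 2 * p.2.2, p.2.1 - p.1 - p.2.2, p.2.2))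
      (fun p => (-p.1 - 2 * p.2.2, p.2.1 - p.1 - p.2.2, p.2.2)) key key ?_ ?_ ?_
    · rintro ⟨x, d, e⟩ -
      ext <;> simp; ring
    · rintro ⟨x, d, e⟩ -
      ext <;> simp; ring
    · rintro ⟨x, d, e⟩ -
      simp only [hf]
      ring
  rw [h1, ← Finset.sum_filter_add_sum_filter_not _ (fun p => 0 < p.2.1 - p.1 - p.2.2), h2,
    ← Finset.sum_add_distrib]
  rw [Finset.sum_neg_distrib] at h3
  omega

/-- Quadruples `(a, b, c, d)` of positive integers with `a * b + c * d = N`. -/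
noncomputable def bilinQuads (N : ℕ) : Finset (ℤ × ℤ × ℤ × ℤ) :=
  (Finset.Icc (1 : ℤ) N ×ˢ Finset.Icc (1 : ℤ) N ×ˢ Finset.Icc (1 : ℤ) N ×ˢ
    Finset.Icc (1 : ℤ) N).filter fun p => p.1 * p.2.1 + p.2.2.1 * p.2.2.2 = N

theorem mem_bilinQuads {N : ℕ} {a b c d : ℤ} :
    (a, b, c, d) ∈ bilinQuads N ↔
      0 < a ∧ 0 < b ∧ 0 < c ∧ 0 < d ∧ a * b + c * d = N := by
  simp only [bilinQuads, Finset.mem_filter, Finset.mem_product, Finset.mem_Icc]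
  constructor
  · rintro ⟨⟨⟨h1, -⟩, ⟨h2, -⟩, ⟨h3, -⟩, h4, -⟩, h⟩
    exact ⟨h1, h2, h3, h4, h⟩
  · rintro ⟨ha, hb, hc, hd, h⟩
    refine ⟨⟨⟨ha, ?_⟩, ⟨hb, ?_⟩, ⟨hc, ?_⟩, ⟨hd, ?_⟩⟩, h⟩ <;>
      nlinarith [mul_pos ha hb, mul_pos hc hd]

/-- The elements of `bilinQuads N` all of whose entries are odd. -/
noncomputable def oddQuads (N : ℕ) : Finset (ℤ × ℤ × ℤ × ℤ) :=
  (bilinQuads N).filter fun p => Odd p.1 ∧ Odd p.2.1 ∧ Odd p.2.2.1 ∧ Odd p.2.2.2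

theorem mem_oddQuads {N : ℕ} {a b c d : ℤ} :
    (a, b, c, d) ∈ oddQuads N ↔ (0 < a ∧ 0 < b ∧ 0 < c ∧ 0 < d ∧ a * b + c * d = N) ∧
      a % 2 = 1 ∧ b % 2 = 1 ∧ c % 2 = 1 ∧ d % 2 = 1 := by
  rw [oddQuads, Finset.mem_filter, mem_bilinQuads]
  simp only [Int.odd_iff]

/-- The elements of `bilinQuads N` whose outer entries are even and inner entries are odd. -/
noncomputable def mixedQuads (N : ℕ) : Finset (ℤ × ℤ × ℤ × ℤ) :=
  (bilinQuads N).filter fun p => Even p.1 ∧ Odd p.2.1 ∧ Odd p.2.2.1 ∧ Even p.2.2.2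

theorem mem_mixedQuads {N : ℕ} {a b c d : ℤ} :
    (a, b, c, d) ∈ mixedQuads N ↔ (0 < a ∧ 0 < b ∧ 0 < c ∧ 0 < d ∧ a * b + c * d = N) ∧
      a % 2 = 0 ∧ b % 2 = 1 ∧ c % 2 = 1 ∧ d % 2 = 0 := by
  rw [mixedQuads, Finset.mem_filter, mem_bilinQuads]
  simp only [Int.odd_iff, Int.even_iff]

theorem sum_mixedQuads_gt (N : ℕ) (F : ℤ → ℤ) :
    ∑ p ∈ mixedQuads N with p.2.1 < p.2.2.2, F p.1 =
      ∑ p ∈ mixedQuads N with p.2.2.1 < p.1, F p.1 := by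
  have h : ∑ p ∈ mixedQuads N with ¬ p.2.1 < p.2.2.2, F p.1 =
      ∑ p ∈ mixedQuads N with ¬ p.2.2.1 < p.1, F p.1 := by
    refine Finset.sum_nbij' (fun p => (p.1, p.2.1 - p.2.2.2, p.2.2.1 + p.1, p.2.2.2))
      (fun p => (p.1, p.2.1 + p.2.2.2, p.2.2.1 - p.1, p.2.2.2))
      ?_ ?_ (by simp) (by simp) (by simp)
    all_goals
      rintro ⟨a, b, c, d⟩ h
      rw [Finset.mem_filter, mem_mixedQuads] at *
      obtain ⟨⟨⟨ha, hb, hc, hd, h⟩, h1, h2, h3, h4⟩, h'⟩ := h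
      simp only at h' ⊢
      refine ⟨⟨⟨?_, ?_, ?_, ?_, by rw [← h]; ring⟩, ?_, ?_, ?_, ?_⟩, ?_⟩ <;> omega
  have h1 := Finset.sum_filter_add_sum_filter_not (mixedQuads N)
    (fun p => p.2.1 < p.2.2.2) (fun p => F p.1)
  have h2 := Finset.sum_filter_add_sum_filter_not (mixedQuads N)
    (fun p => p.2.2.1 < p.1) (fun p => F p.1)
  omega

theorem sum_oddQuads_sub (N : ℕ) (F : ℤ → ℤ) :
    ∑ p ∈ oddQuads N with p.2.2.1 < p.1, F (p.1 - p.2.2.1) =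
      ∑ p ∈ mixedQuads N with p.2.1 < p.2.2.2, F p.1 := by
  refine Finset.sum_nbij' (fun p => (p.1 - p.2.2.1, p.2.1, p.2.2.1, p.2.1 + p.2.2.2))
    (fun p => (p.1 + p.2.2.1, p.2.1, p.2.2.1, p.2.2.2 - p.2.1))
    ?_ ?_ (by simp) (by simp) (by simp)
  all_goals
    rintro ⟨a, b, c, d⟩ h
    rw [Finset.mem_filter] at *
    rw [mem_oddQuads, mem_mixedQuads] at *
    obtain ⟨⟨⟨ha, hb, hc, hd, h⟩, h1, h2, h3, h4⟩, h'⟩ := h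
    simp only at h' ⊢
    refine ⟨⟨⟨?_, ?_, ?_, ?_, by rw [← h]; ring⟩, ?_, ?_, ?_, ?_⟩, ?_⟩ <;> omega

theorem sum_oddQuads_add (N : ℕ) (F : ℤ → ℤ) :
    ∑ p ∈ oddQuads N with p.2.2.2 < p.2.1, F (p.1 + p.2.2.1) =
      ∑ p ∈ mixedQuads N with p.2.2.1 < p.1, F p.1 := by
  refine Finset.sum_nbij' (fun p => (p.1 + p.2.2.1, p.2.2.2, p.1, p.2.1 - p.2.2.2))
    (fun p => (p.2.2.1, p.2.2.2 + p.2.1, p.1 - p.2.2.1, p.2.1))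
    ?_ ?_ (by simp) (by simp) (by simp)
  all_goals
    rintro ⟨a, b, c, d⟩ h
    rw [Finset.mem_filter] at *
    rw [mem_oddQuads, mem_mixedQuads] at *
    obtain ⟨⟨⟨ha, hb, hc, hd, h⟩, h1, h2, h3, h4⟩, h'⟩ := h
    simp only at h' ⊢
    refine ⟨⟨⟨?_, ?_, ?_, ?_, by rw [← h]; ring⟩, ?_, ?_, ?_, ?_⟩, ?_⟩ <;> omega

theorem sum_oddQuads_eq_of_symm (N : ℕ) (G u : ℤ × ℤ × ℤ × ℤ → ℤ)
    (hG : ∀ a b c d, G (c, d, a, b) = G (a, b, c, d))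
    (hu : ∀ a b c d, u (c, d, a, b) = - u (a, b, c, d)) :
    ∑ p ∈ oddQuads N, G p =
      2 * ∑ p ∈ oddQuads N with 0 < u p, G p + ∑ p ∈ oddQuads N with u p = 0, G p := by
  have h : ∑ p ∈ oddQuads N with u p < 0, G p = ∑ p ∈ oddQuads N with 0 < u p, G p := by
    refine Finset.sum_nbij' (fun p => (p.2.2.1, p.2.2.2, p.1, p.2.1))
      (fun p => (p.2.2.1, p.2.2.2, p.1, p.2.1)) ?_ ?_ (by simp) (by simp) (by simp [hG])
    all_goals
      rintro ⟨a, b, c, d⟩ h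
      rw [Finset.mem_filter, mem_oddQuads] at *
      obtain ⟨⟨⟨ha, hb, hc, hd, h⟩, h1, h2, h3, h4⟩, h'⟩ := h
      refine ⟨⟨⟨hc, hd, ha, hb, by rw [← h]; ring⟩, h3, h4, h1, h2⟩, ?_⟩
      have := hu a b c d
      simp only at h' ⊢
      omega
  have h1 := Finset.sum_filter_add_sum_filter_not (oddQuads N) (fun p => 0 < u p) G
  have h2 := Finset.sum_filter_add_sum_filter_not ((oddQuads N).filter fun p => ¬ 0 < u p)
    (fun p => u p = 0) G
  rw [Finset.filter_filter, Finset.filter_filter,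
    Finset.filter_congr (q := fun p => u p = 0) (by intros; omega),
    Finset.filter_congr (p := fun p => ¬ 0 < u p ∧ ¬ u p = 0) (q := fun p => u p < 0)
      (by intros; omega)] at h2
  omega

/-- Liouville's identity for an even function `F`. -/
theorem sum_oddQuads_liouville (N : ℕ) (F : ℤ → ℤ) (hF : ∀ x, F (-x) = F x) :
    ∑ p ∈ oddQuads N, (F (p.1 + p.2.2.1) - F (p.1 - p.2.2.1)) =
      ∑ p ∈ oddQuads N with p.2.1 = p.2.2.2, F (p.1 + p.2.2.1) -
        ∑ p ∈ oddQuads N with p.1 = p.2.2.1, F 0 := by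
  have h1 := sum_oddQuads_eq_of_symm N (fun p => F (p.1 - p.2.2.1)) (fun p => p.1 - p.2.2.1)
    (fun a b c d => by simp only; rw [← hF]; ring_nf) (fun a b c d => by simp)
  have h2 := sum_oddQuads_eq_of_symm N (fun p => F (p.1 + p.2.2.1)) (fun p => p.2.1 - p.2.2.2)
    (fun a b c d => by simp only; rw [add_comm]) (fun a b c d => by simp)
  have h3 : ∑ p ∈ oddQuads N with p.1 - p.2.2.1 = 0, F (p.1 - p.2.2.1) =
      ∑ p ∈ oddQuads N with p.1 = p.2.2.1, F 0 := by
    refine Finset.sum_congr (Finset.filter_congr fun p _ => sub_eq_zero) fun p hp => ?_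
    rw [(Finset.mem_filter.mp hp).2, sub_self]
  simp only [sub_pos] at h1 h2
  rw [h3, sum_oddQuads_sub, sum_mixedQuads_gt] at h1
  rw [sum_oddQuads_add] at h2
  simp only [sub_eq_zero] at h2
  rw [Finset.sum_sub_distrib, h1, h2]
  ring

theorem sum_oddQuads_mul (M : ℕ) :
    ∑ p ∈ oddQuads (2 * M), p.1 * p.2.2.1 =
      ∑ d ∈ M.divisors with Odd (M / d), (d : ℤ) ^ 3 := by
  have h := sum_oddQuads_liouville (2 * M) (fun x => x ^ 2) (by simp)
  have h1 : ∑ p ∈ oddQuads (2 * M) with p.2.1 = p.2.2.2, (p.1 + p.2.2.1) ^ 2 =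
      ∑ q ∈ (M.divisors.filter fun d => Odd (M / d)).sigma fun d => Finset.range d,
        4 * (q.1 : ℤ) ^ 2 := by
    have key : ∀ a b c d : ℤ, (a, b, c, d) ∈ ((oddQuads (2 * M)).filter
        fun p => p.2.1 = p.2.2.2) → (0 < a ∧ 0 < c ∧ a % 2 = 1 ∧ b = d) ∧
          ∃ D B : ℕ, a + c = 2 * D ∧ b = B ∧ 0 < D ∧ Odd B ∧ M = D * B := by
      rintro a b c d h
      rw [Finset.mem_filter, mem_oddQuads] at h
      obtain ⟨⟨⟨ha, hb, hc, hd, h⟩, h1, h2, h3, h4⟩, h'⟩ := h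
      simp only at h'
      subst h'
      obtain ⟨D, hD⟩ : ∃ D : ℕ, a + c = 2 * D := ⟨((a + c) / 2).toNat, by omega⟩
      lift b to ℕ using hb.le
      refine ⟨⟨ha, hc, h1, rfl⟩, D, b, hD, rfl, by omega, by rw [Nat.odd_iff]; omega, ?_⟩
      rw [← add_mul, hD] at h
      push_cast at h
      zify
      linarith
    refine Finset.sum_bij'
      (fun p _ => (⟨((p.1 + p.2.2.1) / 2).toNat, (p.1 / 2).toNat⟩ : (_ : ℕ) × ℕ))
      (fun q _ => ((2 * q.2 + 1 : ℤ), ((M / q.1 : ℕ) : ℤ), (2 * q.1 - 1 - 2 * q.2 : ℤ),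
        ((M / q.1 : ℕ) : ℤ))) ?_ ?_ ?_ ?_ ?_
    · rintro ⟨a, b, c, d⟩ h
      obtain ⟨hab, D, B, hc, hb, hD, hB, hM⟩ := key a b c d h
      simp only [Finset.mem_sigma, Finset.mem_filter, Nat.mem_divisors, Finset.mem_range]
      obtain rfl : D = ((a + c) / 2).toNat := by omega
      refine ⟨⟨⟨⟨B, hM⟩, ?_⟩, ?_⟩, by omega⟩
      · rw [hM]
        exact (Nat.mul_pos hD hB.pos).ne'
      · rwa [hM, Nat.mul_div_cancel_left _ hD]
    · rintro ⟨D, j⟩ h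
      simp only [Finset.mem_sigma, Finset.mem_filter, Nat.mem_divisors, Finset.mem_range] at h
      obtain ⟨⟨⟨⟨B, rfl⟩, hM⟩, hB⟩, hj⟩ := h
      have hD : 0 < D := by omega
      rw [Finset.mem_filter, mem_oddQuads]
      simp only [Nat.mul_div_cancel_left _ hD] at hB ⊢
      have := hB.pos
      rw [Nat.odd_iff] at hB
      refine ⟨⟨⟨by omega, by omega, by omega, by omega, ?_⟩, ?_, ?_, ?_, ?_⟩, trivial⟩
      · push_cast
        ring
      all_goals omega
    · rintro ⟨a, b, c, d⟩ h
      obtain ⟨hab, D, B, hc, hb, hD, hB, hM⟩ := key a b c d h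
      have : (((a + c) / 2).toNat) = D := by omega
      simp only [this, hM, Nat.mul_div_cancel_left _ hD, Prod.mk.injEq]
      omega
    · rintro ⟨D, j⟩ h
      simp only [Sigma.mk.injEq]
      constructor
      · omega
      · rw [heq_eq_eq]
        omega
    · rintro ⟨a, b, c, d⟩ h
      obtain ⟨hab, D, B, hc, hb, hD, hB, hM⟩ := key a b c d h
      have : ((a + c) / 2).toNat = D := by omega
      simp only
      rw [this, hc]
      ring
  simp only [Finset.sum_sigma, Finset.sum_const, Finset.card_range, nsmul_eq_mul] at h1
  simp only [ne_eq, OfNat.ofNat_ne_zero, not_false_eq_true, zero_pow, Finset.sum_const_zero,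
    sub_zero] at h
  rw [h1, Finset.sum_congr rfl (g := fun p => 4 * (p.1 * p.2.2.1)) (fun p _ => by ring),
    ← Finset.mul_sum, Finset.sum_congr rfl (g := fun d : ℕ => 4 * (d : ℤ) ^ 3)
      (fun d _ => by ring), ← Finset.mul_sum] at h
  omega

theorem sum_sigma_mul_sigma (n : ℕ) :
    ∑ q ∈ Finset.HasAntidiagonal.antidiagonal n, (∑ d ∈ (2 * q.1 + 1).divisors, (d : ℤ)) *
        ∑ d ∈ (2 * q.2 + 1).divisors, (d : ℤ) =
      ∑ d ∈ (n + 1).divisors with Odd ((n + 1) / d), (d : ℤ) ^ 3 := by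
  rw [← sum_oddQuads_mul]
  simp only [Finset.sum_mul_sum, ← Finset.sum_product']
  rw [Finset.sum_sigma']
  refine Finset.sum_bij'
    (fun q _ => ((q.2.1 : ℤ), (((2 * q.1.1 + 1) / q.2.1 : ℕ) : ℤ), (q.2.2 : ℤ),
      (((2 * q.1.2 + 1) / q.2.2 : ℕ) : ℤ)))
    (fun p _ => (⟨((p.1.toNat * p.2.1.toNat) / 2, (p.2.2.1.toNat * p.2.2.2.toNat) / 2),
      p.1.toNat, p.2.2.1.toNat⟩ : (_ : ℕ × ℕ) × ℕ × ℕ)) ?_ ?_ ?_ ?_ ?_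
  · rintro ⟨⟨i, j⟩, a, c⟩ h
    simp only [Finset.mem_sigma, Finset.HasAntidiagonal.mem_antidiagonal, Finset.mem_product,
      Nat.mem_divisors] at h
    obtain ⟨rfl, ⟨⟨b, hb⟩, -⟩, ⟨d, hd⟩, -⟩ := h
    have hab : Odd (a * b) := by rw [← hb]; exact odd_two_mul_add_one i
    have hcd : Odd (c * d) := by rw [← hd]; exact odd_two_mul_add_one j
    rw [Nat.odd_mul] at hab hcd
    simp only [hb, hd, Nat.mul_div_cancel_left _ hab.1.pos, Nat.mul_div_cancel_left _ hcd.1.pos]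
    rw [mem_oddQuads]
    simp only [Nat.odd_iff] at hab hcd
    refine ⟨⟨by omega, by omega, by omega, by omega, ?_⟩, by omega, by omega, by omega, by omega⟩
    norm_cast
    omega
  · rintro ⟨a, b, c, d⟩ h
    rw [mem_oddQuads] at h
    obtain ⟨⟨ha, hb, hc, hd, h⟩, h1, h2, h3, h4⟩ := h
    lift a to ℕ using ha.le
    lift b to ℕ using hb.le
    lift c to ℕ using hc.le
    lift d to ℕ using hd.le
    have hab : a * b % 2 = 1 := by
      rw [← Nat.odd_iff, Nat.odd_mul, Nat.odd_iff, Nat.odd_iff]; omega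
    have hcd : c * d % 2 = 1 := by
      rw [← Nat.odd_iff, Nat.odd_mul, Nat.odd_iff, Nat.odd_iff]; omega
    simp only [Finset.mem_sigma, Finset.HasAntidiagonal.mem_antidiagonal, Finset.mem_product,
      Nat.mem_divisors, Int.toNat_natCast]
    norm_cast at h
    refine ⟨by omega, ⟨⟨b, by omega⟩, by omega⟩, ⟨d, by omega⟩, by omega⟩
  · rintro ⟨⟨i, j⟩, a, c⟩ h
    simp only [Finset.mem_sigma, Finset.HasAntidiagonal.mem_antidiagonal, Finset.mem_product,
      Nat.mem_divisors] at h
    obtain ⟨rfl, ⟨hb, -⟩, hd, -⟩ := h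
    simp only [Int.toNat_natCast, Nat.mul_div_cancel' hb, Nat.mul_div_cancel' hd]
    congr <;> omega
  · rintro ⟨a, b, c, d⟩ h
    rw [mem_oddQuads] at h
    obtain ⟨⟨ha, hb, hc, hd, h⟩, h1, h2, h3, h4⟩ := h
    lift a to ℕ using ha.le
    lift b to ℕ using hb.le
    lift c to ℕ using hc.le
    lift d to ℕ using hd.le
    have hab : a * b % 2 = 1 := by
      rw [← Nat.odd_iff, Nat.odd_mul, Nat.odd_iff, Nat.odd_iff]; omega
    have hcd : c * d % 2 = 1 := by
      rw [← Nat.odd_iff, Nat.odd_mul, Nat.odd_iff, Nat.odd_iff]; omega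
    have e1 : 2 * (a * b / 2) + 1 = a * b := by omega
    have e2 : 2 * (c * d / 2) + 1 = c * d := by omega
    simp only [Int.toNat_natCast, e1, e2, Nat.mul_div_cancel_left b (show 0 < a by omega),
      Nat.mul_div_cancel_left d (show 0 < c by omega)]
  · rintro ⟨⟨i, j⟩, a, c⟩ h
    rfl

theorem sum_sub_mul_sigma_triangular (n : ℕ) :
    ∑ q ∈ Finset.HasAntidiagonal.antidiagonal n, ((q.1 : ℤ) - 4 * q.2) *
      (∑ d ∈ (2 * q.1 + 1).divisors, (d : ℤ)) *
        ((Finset.range (n + 1)).filter fun t => t * (t + 1) / 2 = q.2).card = 0 := by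
  set P : ℤ × ℤ × ℤ → ℤ := fun p => (p.2.1 * p.2.2 - p.1 ^ 2) * p.2.1 with hP
  have hodd : ∀ x d e : ℤ, (x, d, e) ∈ discTriples (8 * n + 5) → x % 2 = 1 := by
    intro x d e h
    obtain ⟨-, -, h⟩ := mem_discTriples.mp h
    rw [← Int.odd_iff, ← Int.odd_pow' two_ne_zero, Int.odd_iff]
    push_cast at h
    rw [mul_assoc] at h
    omega
  have h0 : ∑ p ∈ discTriples (8 * n + 5) with 0 < p.1, P p = 0 := by
    have h1 : ∑ p ∈ discTriples (8 * n + 5) with ¬ 0 < p.1, P p =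
        ∑ p ∈ discTriples (8 * n + 5) with 0 < p.1, P p := by
      refine Finset.sum_nbij' (fun p => (-p.1, p.2)) (fun p => (-p.1, p.2))
        ?_ ?_ (by simp) (by simp) (by simp [hP])
      all_goals
        rintro ⟨x, d, e⟩ h
        rw [Finset.mem_filter] at *
        obtain ⟨h, h'⟩ := h
        have := hodd x d e h
        rw [mem_discTriples] at *
        refine ⟨by simpa using h, ?_⟩
        simp only at h' ⊢
        omega
    have h2 := Finset.sum_filter_add_sum_filter_not (discTriples (8 * n + 5))
      (fun p => 0 < p.1) P
    rw [sum_discTriples_eq_zero n] at h2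
    omega
  have key : ∀ x d e : ℤ, (x, d, e) ∈ ((discTriples (8 * n + 5)).filter fun p => 0 < p.1) →
      ∃ t D E i j : ℕ, x = 2 * t + 1 ∧ d = D ∧ e = E ∧ 0 < D ∧ 0 < E ∧ D * E = 2 * i + 1 ∧
        t * (t + 1) = 2 * j ∧ i + j = n := by
    intro x d e h
    rw [Finset.mem_filter] at h
    obtain ⟨h, h'⟩ := h
    have hx := hodd x d e h
    obtain ⟨hd, he, h⟩ := mem_discTriples.mp h
    simp only at h'
    lift d to ℕ using hd.le
    lift e to ℕ using he.le
    obtain ⟨t, rfl⟩ : ∃ t : ℕ, x = 2 * t + 1 := ⟨(x / 2).toNat, by omega⟩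
    obtain ⟨j, hj⟩ := even_iff_two_dvd.mp (Nat.even_mul_succ_self t)
    have h3 : d * e + t * (t + 1) = 2 * n + 1 := by
      zify
      push_cast at h
      linarith
    exact ⟨t, d, e, n - j, j, rfl, rfl, rfl, by omega, by omega, by omega, hj, by omega⟩
  have h1 : ∑ p ∈ discTriples (8 * n + 5) with 0 < p.1, P p =
      ∑ q ∈ (Finset.HasAntidiagonal.antidiagonal n).sigma fun q => (2 * q.1 + 1).divisors ×ˢ
        (Finset.range (n + 1)).filter fun t => t * (t + 1) / 2 = q.2,
          2 * (((q.1.1 : ℤ) - 4 * q.1.2) * q.2.1) := by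
    refine Finset.sum_bij'
      (fun p _ => (⟨(p.2.1.toNat * p.2.2.toNat / 2,
        (p.1 / 2).toNat * ((p.1 / 2).toNat + 1) / 2), p.2.1.toNat, (p.1 / 2).toNat⟩ :
          (_ : ℕ × ℕ) × ℕ × ℕ))
      (fun q _ => ((2 * q.2.2 + 1 : ℤ), (q.2.1 : ℤ), (((2 * q.1.1 + 1) / q.2.1 : ℕ) : ℤ)))
      ?_ ?_ ?_ ?_ ?_
    · intro ⟨x, d, e⟩ h
      obtain ⟨t, d, e, i, j, rfl, rfl, rfl, hd, he, hi, hj, rfl⟩ := key x d e h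
      have ht : ((2 * (t : ℤ) + 1) / 2).toNat = t := by omega
      simp only [Finset.mem_sigma, Finset.HasAntidiagonal.mem_antidiagonal, Finset.mem_product,
        Nat.mem_divisors, Int.toNat_natCast, Finset.mem_filter, Finset.mem_range, ht, hi, hj]
      refine ⟨by omega, ⟨⟨e, by omega⟩, by omega⟩, ?_, trivial⟩
      nlinarith
    · rintro ⟨⟨i, j⟩, d, t⟩ h
      simp only [Finset.mem_sigma, Finset.HasAntidiagonal.mem_antidiagonal, Finset.mem_product,
        Nat.mem_divisors, Finset.mem_filter, Finset.mem_range] at h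
      obtain ⟨rfl, ⟨⟨e, he⟩, -⟩, -, hj⟩ := h
      obtain ⟨j', hj'⟩ := even_iff_two_dvd.mp (Nat.even_mul_succ_self t)
      have hd : 0 < d * e := by omega
      have hd' := Nat.pos_of_mul_pos_right hd
      have he' := Nat.pos_of_mul_pos_left hd
      rw [Finset.mem_filter, mem_discTriples]
      simp only [he, Nat.mul_div_cancel_left _ hd']
      refine ⟨⟨by omega, by omega, ?_⟩, by omega⟩
      have : j' = j := by omega
      subst this
      zify at he hj'
      push_cast
      linarith
    · intro ⟨x, d, e⟩ h
      obtain ⟨t, d, e, i, j, rfl, rfl, rfl, hd, he, hi, hj, rfl⟩ := key x d e h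
      have ht : ((2 * (t : ℤ) + 1) / 2).toNat = t := by omega
      have e1 : 2 * (d * e / 2) + 1 = d * e := by omega
      simp only [Int.toNat_natCast, ht, e1, Nat.mul_div_cancel_left e hd]
    · rintro ⟨⟨i, j⟩, d, t⟩ h
      simp only [Finset.mem_sigma, Finset.HasAntidiagonal.mem_antidiagonal, Finset.mem_product,
        Nat.mem_divisors, Finset.mem_filter, Finset.mem_range] at h
      obtain ⟨rfl, ⟨hd, -⟩, -, hj⟩ := h
      have ht : ((2 * (t : ℤ) + 1) / 2).toNat = t := by omega
      simp only [Int.toNat_natCast, Nat.mul_div_cancel' hd, ht, hj]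
      congr
      omega
    · intro ⟨x, d, e⟩ h
      obtain ⟨t, d, e, i, j, rfl, rfl, rfl, hd, he, hi, hj, rfl⟩ := key x d e h
      have ht : ((2 * (t : ℤ) + 1) / 2).toNat = t := by omega
      have e1 : d * e / 2 = i := by omega
      have e2 : t * (t + 1) / 2 = j := by omega
      simp only [hP, Int.toNat_natCast, ht, e1, e2]
      zify at hi hj
      rw [hi]
      linear_combination (-4 * d : ℤ) * hj
  rw [h0, Finset.sum_sigma, eq_comm] at h1
  simp only [Finset.sum_product, Finset.sum_const, nsmul_eq_mul] at h1
  have h2 : (2 : ℤ) ≠ 0 := two_ne_zero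
  refine (mul_eq_zero.mp ((Finset.mul_sum _ _ _).trans (Eq.trans ?_ h1))).resolve_left h2
  refine Finset.sum_congr rfl fun q _ => ?_
  rw [← Finset.mul_sum, ← Finset.mul_sum, ← Finset.mul_sum]
  ring

open PowerSeries in
/-- The generating series counting the elements of `α` by their weight. -/
noncomputable def weightSeries {α : Type*} (w : α → ℕ) : PowerSeries ℚ :=
  mk fun n => (Nat.card {a // w a = n} : ℚ)

theorem coeff_weightSeries {α : Type*} (w : α → ℕ) (n : ℕ) :
    PowerSeries.coeff n (weightSeries w) = Nat.card {a // w a = n} :=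
  PowerSeries.coeff_mk _ _

theorem weightSeries_comp_equiv {α β : Type*} (e : α ≃ β) (w : β → ℕ) :
    weightSeries (fun a => w (e a)) = weightSeries w := by
  ext n
  rw [coeff_weightSeries, coeff_weightSeries,
    Nat.card_congr (e.subtypeEquiv (p := fun a => w (e a) = n) (q := fun b => w b = n)
      fun _ => Iff.rfl)]

/-- The fibre of a sum of weights decomposes along the antidiagonal. -/
def prodFiberEquiv {α β : Type*} (w : α → ℕ) (v : β → ℕ) (n : ℕ) :
    {p : α × β // w p.1 + v p.2 = n} ≃
      Σ q : {q // q ∈ Finset.HasAntidiagonal.antidiagonal n},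
        {a // w a = q.1.1} × {b // v b = q.1.2} where
  toFun p := ⟨⟨(w p.1.1, v p.1.2), Finset.HasAntidiagonal.mem_antidiagonal.mpr p.2⟩,
    ⟨p.1.1, rfl⟩, ⟨p.1.2, rfl⟩⟩
  invFun s := ⟨(s.2.1.1, s.2.2.1), by
    rw [s.2.1.2, s.2.2.2]
    exact Finset.HasAntidiagonal.mem_antidiagonal.mp s.1.2⟩
  left_inv _ := rfl
  right_inv := by
    rintro ⟨⟨⟨i, j⟩, h⟩, ⟨a, ha⟩, b, hb⟩
    simp only at ha hb
    subst ha hb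
    rfl

theorem finite_fiber_prod {α β : Type*} {w : α → ℕ} {v : β → ℕ}
    (hw : ∀ n, Finite {a // w a = n}) (hv : ∀ n, Finite {b // v b = n}) (n : ℕ) :
    Finite {p : α × β // w p.1 + v p.2 = n} :=
  Finite.of_equiv _ (prodFiberEquiv w v n).symm

theorem weightSeries_prod {α β : Type*} {w : α → ℕ} {v : β → ℕ}
    (hw : ∀ n, Finite {a // w a = n}) (hv : ∀ n, Finite {b // v b = n}) :
    weightSeries (fun p : α × β => w p.1 + v p.2) = weightSeries w * weightSeries v := by
  ext n
  rw [coeff_weightSeries, PowerSeries.coeff_mul, Nat.card_congr (prodFiberEquiv w v n),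
    Nat.card_sigma]
  simp only [Nat.card_prod, coeff_weightSeries, Nat.cast_sum, Nat.cast_mul]
  exact Finset.sum_coe_sort (Finset.HasAntidiagonal.antidiagonal n) fun q : ℕ × ℕ =>
    (Nat.card {a // w a = q.1} : ℚ) * Nat.card {b // v b = q.2}

theorem weightSeries_pow {α : Type*} {w : α → ℕ} (hw : ∀ n, Finite {a // w a = n}) (k : ℕ) :
    (∀ n, Finite {x : Fin k → α // ∑ i, w (x i) = n}) ∧
      weightSeries (fun x : Fin k → α => ∑ i, w (x i)) = weightSeries w ^ k := by
  induction k with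
  | zero =>
    refine ⟨fun n => inferInstance, ?_⟩
    ext n
    rw [coeff_weightSeries, pow_zero, PowerSeries.coeff_one]
    split_ifs with h
    · subst h
      simp
    · have : IsEmpty {x : Fin 0 → α // ∑ i, w (x i) = n} := ⟨fun x => h (by simpa using x.2.symm)⟩
      rw [Nat.card_of_isEmpty, Nat.cast_zero]
  | succ k ih =>
    let e := Fin.consEquiv fun _ : Fin (k + 1) => α
    have he : ∀ p, ∑ i, w (e p i) = w p.1 + ∑ i, w (p.2 i) := fun p => by
      simp [e, Fin.consEquiv, Fin.sum_univ_succ]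
    constructor
    · intro n
      have := finite_fiber_prod hw ih.1 n
      exact Finite.of_equiv _ (e.subtypeEquiv (p := fun p => w p.1 + ∑ i, w (p.2 i) = n)
        (q := fun x => ∑ i, w (x i) = n) fun p => by rw [he])
    · rw [← weightSeries_comp_equiv e]
      simp only [he]
      rw [weightSeries_prod hw ih.1, ih.2, pow_succ']

theorem finite_fiber_of_le {w : ℕ → ℕ} (hw : ∀ t, t ≤ w t) (n : ℕ) : Finite {t // w t = n} :=
  Finite.of_injective (β := Fin (n + 1)) (fun t => ⟨t.1, by have := hw t.1; have := t.2; omega⟩)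
    fun s t h => Subtype.ext (by simpa using h)

theorem le_triangular (t : ℕ) : t ≤ t * (t + 1) / 2 := by
  rw [Nat.le_div_iff_mul_le two_pos]
  rcases t with _ | t
  · simp
  · nlinarith

theorem finite_fiber_natAbs_sq (n : ℕ) : Finite {y : ℤ // y.natAbs ^ 2 = n} :=
  Finite.of_injective (β := Set.Icc (-(n : ℤ)) n) (fun y => ⟨y.1, by
    have h : y.1.natAbs ≤ n := by
      have := y.2
      have := Nat.le_self_pow two_ne_zero y.1.natAbs
      omega
    constructor <;> omega⟩) fun s t h => Subtype.ext (Subtype.mk.inj h)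

/-- The generating series of the triangular numbers. -/
noncomputable def triSeries : PowerSeries ℚ := weightSeries fun t : ℕ => t * (t + 1) / 2

/-- The generating series of doubled triangular numbers. -/
noncomputable def doubleTriSeries : PowerSeries ℚ := weightSeries fun t : ℕ => t * (t + 1)

/-- The theta series of the integer squares. -/
noncomputable def sqSeries : PowerSeries ℚ := weightSeries fun y : ℤ => y.natAbs ^ 2

theorem finite_fiber_triangular (n : ℕ) : Finite {t : ℕ // t * (t + 1) / 2 = n} :=
  finite_fiber_of_le le_triangular n

theorem finite_fiber_double_triangular (n : ℕ) : Finite {t : ℕ // t * (t + 1) = n} :=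
  finite_fiber_of_le (fun t => by nlinarith) n

/-- A weight-preserving bijection behind the identity `ψ(q)² = φ(q) ψ(q²)`. -/
def triPairEquiv : ℕ × ℕ ≃ ℤ × ℕ where
  toFun p :=
    if (p.1 + p.2) % 2 = 0 then (((p.1 : ℤ) - p.2) / 2, (p.1 + p.2) / 2)
    else if p.2 < p.1 then (((p.1 : ℤ) + p.2 + 1) / 2, (p.1 - p.2 - 1) / 2)
    else (-(((p.1 : ℤ) + p.2 + 1) / 2), (p.2 - p.1 - 1) / 2)
  invFun q :=
    if q.2 < q.1 then ((q.1 + q.2).toNat, (q.1 - q.2 - 1).toNat)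
    else if q.1 < -q.2 then ((-q.1 - q.2 - 1).toNat, (-q.1 + q.2).toNat)
    else ((q.2 + q.1).toNat, (q.2 - q.1).toNat)
  left_inv := by
    rintro ⟨a, b⟩
    simp only
    split_ifs <;> simp only [Prod.mk.injEq] at * <;> omega
  right_inv := by
    rintro ⟨m, k⟩
    simp only
    split_ifs <;> simp only [Prod.mk.injEq] at * <;> omega

theorem triPairEquiv_weight (p : ℕ × ℕ) :
    (triPairEquiv p).1.natAbs ^ 2 + (triPairEquiv p).2 * ((triPairEquiv p).2 + 1) =
      p.1 * (p.1 + 1) / 2 + p.2 * (p.2 + 1) / 2 := by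
  obtain ⟨⟨m, k⟩, rfl⟩ := triPairEquiv.symm.surjective p
  rw [Equiv.apply_symm_apply]
  rcases h : triPairEquiv.symm (m, k) with ⟨a, b⟩
  obtain ⟨i, hi⟩ := even_iff_two_dvd.mp (Nat.even_mul_succ_self a)
  obtain ⟨j, hj⟩ := even_iff_two_dvd.mp (Nat.even_mul_succ_self b)
  simp only [hi, hj, Nat.mul_div_cancel_left _ two_pos]
  zify at hi hj ⊢
  rw [sq_abs]
  have h1 : ((a : ℤ) = m + k ∧ (b : ℤ) = m - k - 1) ∨ ((a : ℤ) = -m - k - 1 ∧ (b : ℤ) = -m + k) ∨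
      ((a : ℤ) = k + m ∧ (b : ℤ) = k - m) := by
    simp only [triPairEquiv, Equiv.coe_fn_symm_mk] at h
    split_ifs at h <;> simp only [Prod.mk.injEq] at h <;> omega
  rcases h1 with ⟨ha, hb⟩ | ⟨ha, hb⟩ | ⟨ha, hb⟩ <;> rw [ha] at hi <;> rw [hb] at hj <;>
    linarith

theorem triSeries_sq : triSeries ^ 2 = sqSeries * doubleTriSeries := by
  rw [sq, triSeries, sqSeries, doubleTriSeries,
    ← weightSeries_prod finite_fiber_triangular finite_fiber_triangular,
    ← weightSeries_prod finite_fiber_natAbs_sq finite_fiber_double_triangular,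
    ← weightSeries_comp_equiv triPairEquiv]
  simp only [triPairEquiv_weight]

/-- The generating series of the divisor sums of odd numbers. -/
noncomputable def oddSigmaSeries : PowerSeries ℚ :=
  PowerSeries.mk fun i => ∑ d ∈ (2 * i + 1).divisors, (d : ℚ)

theorem coeff_X_mul_derivative (f : PowerSeries ℚ) (n : ℕ) :
    PowerSeries.coeff n (PowerSeries.X * PowerSeries.derivative ℚ f) =
      n * PowerSeries.coeff n f := by
  cases n with
  | zero => simp
  | succ n =>
    rw [PowerSeries.coeff_succ_X_mul, PowerSeries.coeff_derivative]
    push_cast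
    ring

theorem coeff_triSeries {n j : ℕ} (hj : j ≤ n) : PowerSeries.coeff j triSeries =
    ((Finset.range (n + 1)).filter fun t => t * (t + 1) / 2 = j).card := by
  rw [triSeries, coeff_weightSeries, Nat.subtype_card]
  intro t
  rw [Finset.mem_filter, Finset.mem_range]
  have := le_triangular t
  omega

theorem derivative_oddSigmaSeries_mul :
    PowerSeries.derivative ℚ oddSigmaSeries * triSeries =
      4 * (oddSigmaSeries * PowerSeries.derivative ℚ triSeries) := by
  refine mul_left_cancel₀ (PowerSeries.X_ne_zero (R := ℚ)) ?_
  rw [show (PowerSeries.X : PowerSeries ℚ) *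
      (4 * (oddSigmaSeries * PowerSeries.derivative ℚ triSeries)) =
      PowerSeries.C (4 : ℚ) *
        (oddSigmaSeries * (PowerSeries.X * PowerSeries.derivative ℚ triSeries)) by
    rw [map_ofNat]; ring, ← mul_assoc]
  ext n
  rw [PowerSeries.coeff_C_mul, PowerSeries.coeff_mul, PowerSeries.coeff_mul, ← sub_eq_zero,
    Finset.mul_sum, ← Finset.sum_sub_distrib]
  have h := congrArg (Int.cast : ℤ → ℚ) (sum_sub_mul_sigma_triangular n)
  push_cast at h
  rw [← h]
  refine Finset.sum_congr rfl fun q hq => ?_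
  rw [coeff_X_mul_derivative, coeff_X_mul_derivative,
    coeff_triSeries (Finset.HasAntidiagonal.antidiagonal.snd_le hq), oddSigmaSeries, PowerSeries.coeff_mk]
  ring

/-- The four triangular numbers theorem. -/
theorem triSeries_pow_four : triSeries ^ 4 = oddSigmaSeries := by
  have h0 : PowerSeries.constantCoeff triSeries = 1 := by
    rw [← PowerSeries.coeff_zero_eq_constantCoeff_apply, coeff_triSeries le_rfl]
    rfl
  have hi : triSeries * triSeries⁻¹ = 1 := PowerSeries.mul_inv_cancel _ (by rw [h0]; simp)
  have h1 : oddSigmaSeries * triSeries⁻¹ ^ 4 = 1 := by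
    refine PowerSeries.derivative.ext ?_ ?_
    · have hd := derivative_oddSigmaSeries_mul
      rw [Derivation.leibniz, PowerSeries.derivative_pow, PowerSeries.derivative_inv',
        PowerSeries.derivative_one]
      simp only [smul_eq_mul]
      push_cast
      linear_combination triSeries⁻¹ ^ 5 * hd -
        triSeries⁻¹ ^ 4 * PowerSeries.derivative ℚ oddSigmaSeries * hi
    · rw [map_mul, map_pow, PowerSeries.constantCoeff_inv, h0, oddSigmaSeries,
        ← PowerSeries.coeff_zero_eq_constantCoeff_apply, PowerSeries.coeff_mk]
      simp
  calc triSeries ^ 4 = oddSigmaSeries * triSeries⁻¹ ^ 4 * triSeries ^ 4 := by rw [h1, one_mul]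
    _ = oddSigmaSeries * (triSeries * triSeries⁻¹) ^ 4 := by ring
    _ = oddSigmaSeries := by rw [hi, one_pow, mul_one]

/-- The eight triangular numbers theorem. -/
theorem coeff_triSeries_pow_eight (n : ℕ) : PowerSeries.coeff n (triSeries ^ 8) =
    ∑ d ∈ (n + 1).divisors with Odd ((n + 1) / d), (d : ℚ) ^ 3 := by
  rw [show triSeries ^ 8 = triSeries ^ 4 * triSeries ^ 4 by ring, triSeries_pow_four,
    PowerSeries.coeff_mul]
  have h := congrArg (Int.cast : ℤ → ℚ) (sum_sigma_mul_sigma n)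
  push_cast at h
  rw [← h]
  simp only [oddSigmaSeries, PowerSeries.coeff_mk]

theorem coeff_triSeries_pow (k n : ℕ) :
    PowerSeries.coeff n (triSeries ^ k) = deltaRep k (fun _ => 1) n := by
  rw [triSeries, ← (weightSeries_pow finite_fiber_triangular k).2, coeff_weightSeries, deltaRep,
    ← Nat.card_coe_set_eq]
  simp only [one_mul, eq_comm (a := n), Set.coe_ofPred]

theorem coeff_sqSeries_pow (k n : ℕ) :
    PowerSeries.coeff n (sqSeries ^ k) = rRep k (fun _ => 1) n := by
  rw [sqSeries, ← (weightSeries_pow finite_fiber_natAbs_sq k).2, coeff_weightSeries, rRep,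
    ← Nat.card_coe_set_eq]
  have h : ∀ y : Fin k → ℤ, ∑ i, (y i).natAbs ^ 2 = n ↔ (n : ℤ) = ∑ i, ((1 : ℕ) : ℤ) * y i ^ 2 := by
    intro y
    rw [eq_comm, ← Nat.cast_inj (R := ℤ)]
    push_cast
    simp
  simp only [h, Set.coe_ofPred]

theorem coeff_doubleTriSeries_pow (k n : ℕ) : PowerSeries.coeff n (doubleTriSeries ^ k) =
    if Even n then PowerSeries.coeff (n / 2) (triSeries ^ k) else 0 := by
  rw [doubleTriSeries, triSeries, ← (weightSeries_pow finite_fiber_triangular k).2,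
    ← (weightSeries_pow finite_fiber_double_triangular k).2, coeff_weightSeries,
    coeff_weightSeries]
  have h : ∀ x : Fin k → ℕ, ∑ i, x i * (x i + 1) = 2 * ∑ i, x i * (x i + 1) / 2 := by
    intro x
    rw [Finset.mul_sum]
    exact Finset.sum_congr rfl fun i _ =>
      (Nat.mul_div_cancel' (even_iff_two_dvd.mp (Nat.even_mul_succ_self _))).symm
  simp only [h]
  split_ifs with hn
  · obtain ⟨m, rfl⟩ := even_iff_two_dvd.mp hn
    simp
  · have : IsEmpty {x : Fin k → ℕ // 2 * ∑ i, x i * (x i + 1) / 2 = n} :=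
      ⟨fun x => hn (x.2 ▸ even_two_mul _)⟩
    simp

theorem delta_sixteen_formula (n : ℕ)
    (sigma3sharp : ℕ → ℕ)
    (hsig : ∀ m : ℕ, sigma3sharp m =
      ∑ d ∈ m.divisors.filter (fun d => Odd (m / d)), d ^ 3) :
    deltaRep 16 (fun _ => 1) n =
      ∑ p ∈ convPairs n, rRep 8 (fun _ => 1) p.1 * sigma3sharp (p.2 + 1) := by
  have h8 : ∀ b, PowerSeries.coeff b (triSeries ^ 8) = (sigma3sharp (b + 1) : ℚ) := fun b => by
    rw [coeff_triSeries_pow_eight, hsig]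
    push_cast
    rfl
  have h : triSeries ^ 16 = sqSeries ^ 8 * doubleTriSeries ^ 8 := by
    rw [← mul_pow, ← triSeries_sq, ← pow_mul]
  rw [← Nat.cast_inj (R := ℚ), ← coeff_triSeries_pow, h, PowerSeries.coeff_mul]
  simp only [coeff_doubleTriSeries_pow, h8, coeff_sqSeries_pow, mul_ite, mul_zero]
  rw [← Finset.sum_filter]
  push_cast
  symm
  refine Finset.sum_nbij' (fun p => (p.1, 2 * p.2)) (fun p => (p.1, p.2 / 2)) ?_ ?_ ?_ ?_ ?_
  · rintro ⟨a, b⟩ h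
    simp only [convPairs, Finset.mem_filter] at h
    simpa using h.2
  · rintro ⟨a, b⟩ h
    simp only [Finset.mem_filter, Finset.HasAntidiagonal.mem_antidiagonal, Nat.even_iff] at h
    simp only [convPairs, Finset.mem_filter, Finset.mem_product, Finset.mem_range]
    omega
  · simp
  · rintro ⟨a, b⟩ h
    simp only [Finset.mem_filter, Nat.even_iff] at h
    simp only [Prod.mk.injEq, true_and]
    omega
  · simp
end
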